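/- arXiv:2305.14943 — 4 statements merged into one kernel-verified Lean document; each statement's English description precedes it below -/
import Mathlib

section
/- Suppose (μ_t)_{t≥0} is a family of probability measures on Ω, each with a continuously differentiable strictly positive density r_t = dμ_t/dπ with respect to π; let ν = (∇φ)_#π and η_t = (∇φ)_#μ_t. If the map t ↦ χ²(η_t‖ν) = ∫ (dη_t/dν − 1)² dν is differentiable with derivative d/dt χ²(η_t‖ν) = −∫_{ℝ^d} ⟨∇_y log(dη_t/dν)(y), 2 ∇_y (dη_t/dν)(y)⟩ dη_t(y) for every t ≥ 0, then t ↦ χ²(μ_t‖π) is differentiable with d/dt χ²(μ_t‖π) = −2 J_φ(μ_t‖π) = −2 ∫_Ω ‖(∇²φ(x))⁻¹ ∇ r_t(x)‖² dπ(x) for every t ≥ 0. -/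
open MeasureTheory Set
open scoped ENNReal NNReal RealInnerProductSpace

abbrev Euc (d : ℕ) : Type := EuclideanSpace ℝ (Fin d)

/-- The derivative of a gradient field on a neighbourhood is symmetric. -/
theorem inner_fderiv_gradient_symm {E : Type*} [NormedAddCommGroup E] [InnerProductSpace ℝ E]
    [CompleteSpace E] {φ : E → ℝ} {g : E → E} {x : E} {H : E →L[ℝ] E}
    (hg : ∀ᶠ y in nhds x, HasGradientAt φ (g y) y) (hH : HasFDerivAt g H x) (v w : E) :
    ⟪H v, w⟫ = ⟪H w, v⟫ := by
  let L : E →L[ℝ] E →L[ℝ] ℝ := innerSL ℝ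
  have hgL : ∀ᶠ y in nhds x, HasFDerivAt φ (L (g y)) y := hg.mono fun y hy => hy.hasFDerivAt
  exact second_derivative_symmetric_of_eventually hgL (L.hasFDerivAt.comp x hH) v w

/-- A right inverse of a symmetric operator is symmetric. -/
theorem inner_symm_of_comp_eq_id {E : Type*} [NormedAddCommGroup E] [InnerProductSpace ℝ E]
    {H K : E →L[ℝ] E} (hH : ∀ v w, ⟪H v, w⟫ = ⟪H w, v⟫)
    (hHK : H.comp K = ContinuousLinearMap.id ℝ E) (v w : E) :
    ⟪K v, w⟫ = ⟪v, K w⟫ := by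
  have hK (u : E) : H (K u) = u := DFunLike.congr_fun hHK u
  have := hH (K w) (K v)
  rw [hK, hK] at this
  rw [real_inner_comm, this]

/-- Chain rule for gradients along a map whose derivative is symmetric. -/
theorem HasGradientAt.comp_of_symm {E : Type*} [NormedAddCommGroup E] [InnerProductSpace ℝ E]
    [CompleteSpace E] {f : E → ℝ} {g : E → E} {y v : E} {K : E →L[ℝ] E}
    (hf : HasGradientAt f v (g y)) (hg : HasFDerivAt g K y)
    (hK : ∀ v w, ⟪K v, w⟫ = ⟪v, K w⟫) :
    HasGradientAt (fun z => f (g z)) (K v) y := by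
  rw [hasGradientAt_iff_hasFDerivAt] at hf ⊢
  refine (hf.comp y hg).congr_fderiv ?_
  ext w
  simp [hK]

/-- The gradient of the logarithm of a function. -/
theorem HasGradientAt.log {E : Type*} [NormedAddCommGroup E] [InnerProductSpace ℝ E]
    [CompleteSpace E] {f : E → ℝ} {y v : E} (hf : HasGradientAt f v y) (hy : f y ≠ 0) :
    HasGradientAt (fun z => Real.log (f z)) ((f y)⁻¹ • v) y := by
  rw [hasGradientAt_iff_hasFDerivAt] at hf ⊢
  simpa using hf.log hy

/-- Pushing a measure forward along a map and then integrating a function composed with an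
injective inverse on a conull set recovers the original integral, for arbitrary integrands. -/
theorem integral_comp_map_of_leftInvOn {E F : Type*} [MeasurableSpace E] [MeasurableSpace F]
    {ρ : Measure E} {S : Set E} (hS : ρ Sᶜ = 0) {g : E → F} {h : F → E} (hg : Measurable g)
    (hh : MeasurableEmbedding h) (hgh : LeftInvOn h g S) (f : E → ℝ) :
    ∫ y, f (h y) ∂(ρ.map g) = ∫ x, f x ∂ρ := by
  rw [← hh.integral_map, Measure.map_map hh.measurable hg]
  have hae : h ∘ g =ᵐ[ρ] id := by
    filter_upwards [mem_ae_iff.2 hS] with x hx using hgh hx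
  rw [Measure.map_congr hae, Measure.map_id]

/-- Dissipation of the chi-squared divergence along the mirrored
Wasserstein gradient flow: if `t ↦ χ²(η_t‖ν)` dissipates in the dual space, then
`t ↦ χ²(μ_t‖π)` dissipates at rate `−2 J_φ(μ_t‖π)`, the mirrored Dirichlet energy. -/
theorem chisq_dissipation_mirrored
    (d : ℕ) (hd : 1 ≤ d)
    (X Ω : Set (Euc d)) (hX : Convex ℝ X) (hΩX : Ω = interior X) (hΩne : Ω.Nonempty)
    (φ : Euc d → ℝ) (hφ : ContDiffOn ℝ 2 φ Ω) (hφconv : StrictConvexOn ℝ Ω φ)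
    (gradφ gradφstar : Euc d → Euc d)
    (hgradφ : ∀ x ∈ Ω, HasGradientAt φ (gradφ x) x)
    (hgradφ_meas : Measurable gradφ)
    (hstar_mem : ∀ y, gradφstar y ∈ Ω)
    (hstar_left : ∀ x ∈ Ω, gradφstar (gradφ x) = x)
    (hstar_right : ∀ y, gradφ (gradφstar y) = y)
    (hstar_diff : Differentiable ℝ gradφstar)
    (Hess Hinv : Euc d → Euc d →L[ℝ] Euc d)
    (hHess : ∀ x ∈ Ω, HasFDerivAt gradφ (Hess x) x)
    (hHinv_left : ∀ x ∈ Ω, (Hinv x).comp (Hess x) = ContinuousLinearMap.id ℝ (Euc d))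
    (hHinv_right : ∀ x ∈ Ω, (Hess x).comp (Hinv x) = ContinuousLinearMap.id ℝ (Euc d))
    (hstar_fderiv : ∀ x ∈ Ω, HasFDerivAt gradφstar (Hinv x) (gradφ x))
    (π : Measure (Euc d)) (hπprob : IsProbabilityMeasure π) (hπΩ : π Ωᶜ = 0)
    (μ : ℝ → Measure (Euc d)) (hμprob : ∀ t, 0 ≤ t → IsProbabilityMeasure (μ t))
    (r : ℝ → Euc d → ℝ)
    (hr_smooth : ∀ t, 0 ≤ t → ContDiffOn ℝ 1 (r t) Ω)
    (hr_pos : ∀ t, 0 ≤ t → ∀ x ∈ Ω, 0 < r t x)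
    (hμdens : ∀ t, 0 ≤ t → μ t = π.withDensity (fun x => ENNReal.ofReal (r t x)))
    (ν : Measure (Euc d)) (hν : ν = Measure.map gradφ π)
    (η : ℝ → Measure (Euc d)) (hη : ∀ t, η t = Measure.map gradφ (μ t))
    (hmirror : ∀ t, 0 ≤ t →
      HasDerivAt (fun s => ∫ y, (r s (gradφstar y) - 1) ^ 2 ∂ν)
        (-∫ y, ⟪gradient (fun z => Real.log (r t (gradφstar z))) y,
                (2 : ℝ) • gradient (fun z => r t (gradφstar z)) y⟫ ∂(η t)) t) :
    ∀ t, 0 ≤ t →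
      HasDerivAt (fun s => ∫ x, (r s x - 1) ^ 2 ∂π)
        (-(2 * ∫ x in Ω, ‖Hinv x (gradient (r t) x)‖ ^ 2 ∂π)) t := by
  subst hΩX hν
  have hopen : IsOpen (interior X) := isOpen_interior
  have hemb : MeasurableEmbedding gradφstar :=
    hstar_diff.continuous.measurableEmbedding (Function.LeftInverse.injective hstar_right)
  have hπmem : ∀ᵐ x ∂π, x ∈ interior X := mem_ae_iff.2 hπΩ
  intro t ht
  have hsymm (x) (hx : x ∈ interior X) (v w : Euc d) : ⟪Hinv x v, w⟫ = ⟪v, Hinv x w⟫ :=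
    inner_symm_of_comp_eq_id
      (inner_fderiv_gradient_symm ((hopen.eventually_mem hx).mono hgradφ) (hHess x hx))
      (hHinv_right x hx) v w
  have hgrad (x) (hx : x ∈ interior X) : HasGradientAt (fun z => r t (gradφstar z))
      (Hinv x (gradient (r t) x)) (gradφ x) := by
    have hr : HasGradientAt (r t) (gradient (r t) x) (gradφstar (gradφ x)) := by
      rw [hstar_left x hx]
      exact (((hr_smooth t ht).contDiffAt (hopen.mem_nhds hx)).differentiableAt
        one_ne_zero).hasGradientAt
    exact hr.comp_of_symm (hstar_fderiv x hx) (hsymm x hx)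
  have hμΩ : μ t (interior X)ᶜ = 0 := by
    rw [hμdens t ht]
    exact withDensity_absolutelyContinuous _ _ hπΩ
  have hr_meas : AEMeasurable (fun x => ENNReal.ofReal (r t x)) π := by
    rw [← Measure.restrict_eq_self_of_ae_mem hπmem]
    exact ((hr_smooth t ht).continuousOn.aemeasurable hopen.measurableSet).ennreal_ofReal
  have henergy : ∫ y, ⟪gradient (fun z => Real.log (r t (gradφstar z))) y,
      (2 : ℝ) • gradient (fun z => r t (gradφstar z)) y⟫ ∂(η t) =
      2 * ∫ x in interior X, ‖Hinv x (gradient (r t) x)‖ ^ 2 ∂π := by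
    have hpull := integral_comp_map_of_leftInvOn hμΩ hgradφ_meas hemb hstar_left fun x =>
      ⟪gradient (fun z => Real.log (r t (gradφstar z))) (gradφ x),
        (2 : ℝ) • gradient (fun z => r t (gradφstar z)) (gradφ x)⟫
    simp only [hstar_right] at hpull
    rw [hη, hpull, hμdens t ht, integral_withDensity_eq_integral_toReal_smul₀ hr_meas
      (by simp), Measure.restrict_eq_self_of_ae_mem hπmem, ← integral_const_mul]
    refine integral_congr_ae ?_
    filter_upwards [hπmem] with x hx
    have hpos := hr_pos t ht x hx
    have hlog := (hgrad x hx).log (by rw [hstar_left x hx]; exact hpos.ne')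
    rw [hlog.gradient, (hgrad x hx).gradient, hstar_left x hx, ENNReal.toReal_ofReal hpos.le,
      real_inner_smul_left, real_inner_smul_right, real_inner_self_eq_norm_sq, smul_eq_mul,
      mul_inv_cancel_left₀ hpos.ne']
  have hchisq := hmirror t ht
  rw [henergy] at hchisq
  refine hchisq.congr_of_eventuallyEq (.of_forall fun s => ?_)
  exact (integral_comp_map_of_leftInvOn hπΩ hgradφ_meas hemb hstar_left
    fun x => (r s x - 1) ^ 2).symm
end

section
/- Suppose (μ_t)_{t≥0} is a family of probability measures on Ω, each with a continuously differentiable strictly positive density r_t = dμ_t/dπ with respect to π; let ν = (∇φ)_#π and η_t = (∇φ)_#μ_t. If the map t ↦ χ²(η_t‖ν) = ∫ (dη_t/dν − 1)² dν is differentiable with derivative d/dt χ²(η_t‖ν) = −4 ∫_{ℝ^d} ‖∇_y (dη_t/dν)(y)‖² dη_t(y) for every t ≥ 0, then t ↦ χ²(μ_t‖π) is differentiable with d/dt χ²(μ_t‖π) = −4 ∫_Ω ‖(∇²φ(x))⁻¹ ∇ r_t(x)‖² dμ_t(x) for every t ≥ 0. -/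
open MeasureTheory Set
open scoped ENNReal NNReal RealInnerProductSpace

/-- The derivative of a gradient field is a symmetric operator. -/
theorem inner_fderiv_gradient_comm {E : Type*} [NormedAddCommGroup E] [InnerProductSpace ℝ E]
    [CompleteSpace E] {f : E → ℝ} {g : E → E} {H : E →L[ℝ] E} {x : E}
    (hf : ∀ᶠ z in nhds x, HasGradientAt f (g z) z) (hg : HasFDerivAt g H x) (u v : E) :
    ⟪H u, v⟫ = ⟪u, H v⟫ := by
  have hg' : HasFDerivAt (fun z => innerSL ℝ (g z)) ((innerSL ℝ).comp H) x :=
    (innerSL ℝ).hasFDerivAt.comp x hg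
  have h := second_derivative_symmetric_of_eventually (f := f)
    (hf.mono fun z hz => hz.hasFDerivAt) hg' u v
  simpa [real_inner_comm] using h

/-- The chain rule for gradients when the derivative of the inner map is symmetric. -/
theorem gradient_comp_of_symmetric {E : Type*} [NormedAddCommGroup E] [InnerProductSpace ℝ E]
    [CompleteSpace E] {f : E → ℝ} {g : E → E} {A : E →L[ℝ] E} {y : E}
    (hf : DifferentiableAt ℝ f (g y)) (hg : HasFDerivAt g A y)
    (hA : ∀ u v, ⟪A u, v⟫ = ⟪u, A v⟫) :
    gradient (fun z => f (g z)) y = A (gradient f (g y)) := by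
  have h := hf.hasGradientAt.hasFDerivAt.comp y hg
  have hdual : InnerProductSpace.toDual ℝ E (A (gradient f (g y))) =
      (InnerProductSpace.toDual ℝ E (gradient f (g y))).comp A := by
    ext v
    simp [hA]
  exact HasGradientAt.gradient (hasGradientAt_iff_hasFDerivAt.2 (hdual ▸ h))

/-- Pushing a measure forward along a map and back along an almost everywhere left inverse that is
continuous and injective transports integrals of arbitrary functions. -/
theorem integral_map_comp_leftInverse {E : Type*} [MeasurableSpace E] [TopologicalSpace E]
    [PolishSpace E] [BorelSpace E] {m : Measure E} {g h : E → E} (hg : Measurable g)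
    (hh : Continuous h) (hinj : Function.Injective h) (hinv : ∀ᵐ x ∂m, h (g x) = x)
    (F : E → ℝ) : ∫ y, F (h y) ∂(m.map g) = ∫ x, F x ∂m := by
  rw [← (hh.measurableEmbedding hinj).integral_map, Measure.map_map hh.measurable hg,
    Measure.map_congr (f := h ∘ g) (g := id) hinv, Measure.map_id]

/-- Dissipation of the chi-squared divergence along the mirrored
Wasserstein gradient flow of the chi-squared divergence, expressed in the primal space. -/
theorem chisq_dissipation_mirrored_chisq_flow
    (d : ℕ) (hd : 1 ≤ d)
    (X Ω : Set (Euc d)) (hX : Convex ℝ X) (hΩX : Ω = interior X) (hΩne : Ω.Nonempty)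
    (φ : Euc d → ℝ) (hφ : ContDiffOn ℝ 2 φ Ω) (hφconv : StrictConvexOn ℝ Ω φ)
    (gradφ gradφstar : Euc d → Euc d)
    (hgradφ : ∀ x ∈ Ω, HasGradientAt φ (gradφ x) x)
    (hgradφ_meas : Measurable gradφ)
    (hstar_mem : ∀ y, gradφstar y ∈ Ω)
    (hstar_left : ∀ x ∈ Ω, gradφstar (gradφ x) = x)
    (hstar_right : ∀ y, gradφ (gradφstar y) = y)
    (hstar_diff : Differentiable ℝ gradφstar)
    (Hess Hinv : Euc d → Euc d →L[ℝ] Euc d)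
    (hHess : ∀ x ∈ Ω, HasFDerivAt gradφ (Hess x) x)
    (hHinv_left : ∀ x ∈ Ω, (Hinv x).comp (Hess x) = ContinuousLinearMap.id ℝ (Euc d))
    (hHinv_right : ∀ x ∈ Ω, (Hess x).comp (Hinv x) = ContinuousLinearMap.id ℝ (Euc d))
    (hstar_fderiv : ∀ x ∈ Ω, HasFDerivAt gradφstar (Hinv x) (gradφ x))
    (π : Measure (Euc d)) (hπprob : IsProbabilityMeasure π) (hπΩ : π Ωᶜ = 0)
    (μ : ℝ → Measure (Euc d)) (hμprob : ∀ t, 0 ≤ t → IsProbabilityMeasure (μ t))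
    (r : ℝ → Euc d → ℝ)
    (hr_smooth : ∀ t, 0 ≤ t → ContDiffOn ℝ 1 (r t) Ω)
    (hr_pos : ∀ t, 0 ≤ t → ∀ x ∈ Ω, 0 < r t x)
    (hμdens : ∀ t, 0 ≤ t → μ t = π.withDensity (fun x => ENNReal.ofReal (r t x)))
    (ν : Measure (Euc d)) (hν : ν = Measure.map gradφ π)
    (η : ℝ → Measure (Euc d)) (hη : ∀ t, η t = Measure.map gradφ (μ t))
    (hmirror : ∀ t, 0 ≤ t →
      HasDerivAt (fun s => ∫ y, (r s (gradφstar y) - 1) ^ 2 ∂ν)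
        (-(4 * ∫ y, ‖gradient (fun z => r t (gradφstar z)) y‖ ^ 2 ∂(η t))) t) :
    ∀ t, 0 ≤ t →
      HasDerivAt (fun s => ∫ x, (r s x - 1) ^ 2 ∂π)
        (-(4 * ∫ x in Ω, ‖Hinv x (gradient (r t) x)‖ ^ 2 ∂(μ t))) t := by
  have hΩo : IsOpen Ω := hΩX ▸ isOpen_interior
  have hinj : Function.Injective gradφstar :=
    Function.LeftInverse.injective hstar_right
  have hπ : ∀ᵐ x ∂π, x ∈ Ω := hπΩ
  have hsymm : ∀ x ∈ Ω, ∀ u v, ⟪Hinv x u, v⟫ = ⟪u, Hinv x v⟫ := by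
    intro x hx u v
    have h := inner_fderiv_gradient_comm
      (Filter.eventually_of_mem (hΩo.mem_nhds hx) hgradφ) (hHess x hx) (Hinv x u) (Hinv x v)
    have hHess_Hinv : ∀ w, Hess x (Hinv x w) = w := DFunLike.congr_fun (hHinv_right x hx)
    rw [hHess_Hinv, hHess_Hinv] at h
    exact h.symm
  intro t ht
  have hμ : ∀ᵐ x ∂(μ t), x ∈ Ω := by
    rw [hμdens t ht]
    exact (withDensity_absolutelyContinuous _ _).ae_le hπ
  have hgrad : ∀ y, gradient (fun z => r t (gradφstar z)) y =
      Hinv (gradφstar y) (gradient (r t) (gradφstar y)) := by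
    intro y
    have hy := hstar_mem y
    have hderiv := hstar_fderiv _ hy
    rw [hstar_right] at hderiv
    exact gradient_comp_of_symmetric
      (((hr_smooth t ht).differentiableOn one_ne_zero).differentiableAt (hΩo.mem_nhds hy))
      hderiv (hsymm _ hy)
  have hmain := hmirror t ht
  simp only [hgrad, hν, hη] at hmain
  rw [integral_map_comp_leftInverse hgradφ_meas hstar_diff.continuous hinj
    (hμ.mono hstar_left) (fun x => ‖Hinv x (gradient (r t) x)‖ ^ 2)] at hmain
  rw [Measure.restrict_eq_self_of_ae_mem hμ]
  convert hmain using 2 with s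
  exact (integral_map_comp_leftInverse hgradφ_meas hstar_diff.continuous hinj
    (hπ.mono hstar_left) (fun x => (r s x - 1) ^ 2)).symm
end

section
/- Let k : Ω × Ω → ℝ be a Borel-measurable kernel, let μ be a Borel probability measure on Ω, and let h : Ω → ℝ be continuously differentiable. Setting η = (∇φ)_#μ, the following double-integral change-of-variables identity holds: ∬_{ℝ^d×ℝ^d} k(∇φ*(y), ∇φ*(y')) ⟨∇_y (h ∘ ∇φ*)(y), ∇_{y'} (h ∘ ∇φ*)(y')⟩ dη(y) dη(y') = ∬_{Ω×Ω} k(x, x') ⟨(∇²φ(x))⁻¹ ∇h(x), (∇²φ(x'))⁻¹ ∇h(x')⟩ dμ(x) dμ(x'). -/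
open MeasureTheory Set
open scoped ENNReal NNReal RealInnerProductSpace

/-- The gradient of any function on a finite-dimensional Euclidean space is measurable. -/
theorem measurable_gradient {d : ℕ} (f : Euc d → ℝ) : Measurable (gradient f) :=
  (InnerProductSpace.toDual ℝ (Euc d)).symm.continuous.measurable.comp (measurable_fderiv ℝ f)

/-- Chain rule for gradients: the derivative of the inner map enters through its adjoint. -/
theorem HasGradientAt.comp_hasFDerivAt {d : ℕ} {f : Euc d → ℝ} {g : Euc d → Euc d}
    {f' : Euc d} {g' : Euc d →L[ℝ] Euc d} {y : Euc d}
    (hf : HasGradientAt f f' (g y)) (hg : HasFDerivAt g g' y) :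
    HasGradientAt (fun z => f (g z)) (g'.adjoint f') y := by
  rw [hasGradientAt_iff_hasFDerivAt] at hf ⊢
  have hdual : InnerProductSpace.toDual ℝ (Euc d) (g'.adjoint f') =
      (InnerProductSpace.toDual ℝ (Euc d) f').comp g' := by
    ext1 v
    simp only [InnerProductSpace.toDual_apply_apply, ContinuousLinearMap.comp_apply,
      ContinuousLinearMap.adjoint_inner_left]
  rw [hdual]
  exact hf.comp y hg

/-- A two-sided inverse of a symmetric operator is self-adjoint. -/
theorem adjoint_eq_of_inverse_of_symmetric {d : ℕ} {A B : Euc d →L[ℝ] Euc d}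
    (hAB : A.comp B = ContinuousLinearMap.id ℝ (Euc d))
    (hA : ∀ u v : Euc d, ⟪A u, v⟫ = ⟪u, A v⟫) : B.adjoint = B := by
  have hAB' : ∀ v, A (B v) = v := fun v => congrArg (fun T => T v) hAB
  symm
  rw [ContinuousLinearMap.eq_adjoint_iff]
  intro u v
  calc ⟪B u, v⟫ = ⟪B u, A (B v)⟫ := by rw [hAB']
    _ = ⟪u, B v⟫ := by rw [← hA, hAB']

/-- Change of variables in an iterated integral against a pushforward measure. -/
theorem integral_integral_map {α β : Type*} [MeasurableSpace α] [MeasurableSpace β]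
    {μ : Measure α} [SFinite μ] {g : α → β} (hg : Measurable g) {f : β → β → ℝ}
    (hf : Measurable (fun p : β × β => f p.1 p.2)) :
    ∫ y, ∫ y', f y y' ∂(Measure.map g μ) ∂(Measure.map g μ) =
      ∫ x, ∫ x', f (g x) (g x') ∂μ ∂μ := by
  rw [integral_map hg.aemeasurable
    hf.stronglyMeasurable.integral_prod_right'.aestronglyMeasurable]
  congr 1 with x
  exact integral_map hg.aemeasurable
    (hf.comp measurable_prodMk_left).aestronglyMeasurable

/-- Double-integral change-of-variables identity for the kernelised
Stein-Fisher information under the mirror map. -/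
theorem stein_discrepancy_change_of_variables
    (d : ℕ) (hd : 1 ≤ d)
    (X Ω : Set (Euc d)) (hX : Convex ℝ X) (hΩX : Ω = interior X) (hΩne : Ω.Nonempty)
    (φ : Euc d → ℝ) (hφ : ContDiffOn ℝ 2 φ Ω) (hφconv : StrictConvexOn ℝ Ω φ)
    (gradφ gradφstar : Euc d → Euc d)
    (hgradφ : ∀ x ∈ Ω, HasGradientAt φ (gradφ x) x)
    (hgradφ_meas : Measurable gradφ)
    (hstar_mem : ∀ y, gradφstar y ∈ Ω)
    (hstar_left : ∀ x ∈ Ω, gradφstar (gradφ x) = x)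
    (hstar_right : ∀ y, gradφ (gradφstar y) = y)
    (hstar_diff : Differentiable ℝ gradφstar)
    (Hess Hinv : Euc d → Euc d →L[ℝ] Euc d)
    (hHess : ∀ x ∈ Ω, HasFDerivAt gradφ (Hess x) x)
    (hHinv_left : ∀ x ∈ Ω, (Hinv x).comp (Hess x) = ContinuousLinearMap.id ℝ (Euc d))
    (hHinv_right : ∀ x ∈ Ω, (Hess x).comp (Hinv x) = ContinuousLinearMap.id ℝ (Euc d))
    (hstar_fderiv : ∀ x ∈ Ω, HasFDerivAt gradφstar (Hinv x) (gradφ x))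
    (hHess_symm : ∀ x ∈ Ω, ∀ u v : Euc d, ⟪Hess x u, v⟫ = ⟪u, Hess x v⟫)
    (k : Euc d → Euc d → ℝ)
    (hk_meas : Measurable (fun p : Euc d × Euc d => k p.1 p.2))
    (μ : Measure (Euc d)) (hμprob : IsProbabilityMeasure μ) (hμΩ : μ Ωᶜ = 0)
    (h : Euc d → ℝ) (hh : ContDiffOn ℝ 1 h Ω) :
    ∫ y, ∫ y', k (gradφstar y) (gradφstar y') *
        ⟪gradient (fun z => h (gradφstar z)) y, gradient (fun z => h (gradφstar z)) y'⟫
      ∂(Measure.map gradφ μ) ∂(Measure.map gradφ μ) =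
    ∫ x in Ω, ∫ x' in Ω, k x x' * ⟪Hinv x (gradient h x), Hinv x' (gradient h x')⟫ ∂μ ∂μ := by
  have hΩ : IsOpen Ω := hΩX ▸ isOpen_interior
  have hae : ∀ᵐ x ∂μ, x ∈ Ω := by rwa [ae_iff]
  have hgrad : ∀ x ∈ Ω,
      gradient (fun z => h (gradφstar z)) (gradφ x) = Hinv x (gradient h x) := by
    intro x hx
    have hdiff : DifferentiableAt ℝ h (gradφstar (gradφ x)) := by
      rw [hstar_left x hx]
      exact (hh.differentiableOn one_ne_zero).differentiableAt (hΩ.mem_nhds hx)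
    rw [(hdiff.hasGradientAt.comp_hasFDerivAt (hstar_fderiv x hx)).gradient,
      adjoint_eq_of_inverse_of_symmetric (hHinv_right x hx) (hHess_symm x hx), hstar_left x hx]
  have hmeas : Measurable (fun p : Euc d × Euc d => k (gradφstar p.1) (gradφstar p.2) *
      ⟪gradient (fun z => h (gradφstar z)) p.1, gradient (fun z => h (gradφstar z)) p.2⟫) := by
    have hs := hstar_diff.continuous.measurable
    have hG := measurable_gradient (fun z => h (gradφstar z))
    exact (hk_meas.comp ((hs.comp measurable_fst).prodMk (hs.comp measurable_snd))).mul
      ((hG.comp measurable_fst).inner (hG.comp measurable_snd))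
  rw [integral_integral_map hgradφ_meas hmeas, Measure.restrict_eq_self_of_ae_mem hae]
  refine integral_congr_ae ?_
  filter_upwards [hae] with x hx
  refine integral_congr_ae ?_
  filter_upwards [hae] with x' hx'
  simp only [hstar_left x hx, hstar_left x' hx', hgrad x hx, hgrad x' hx']
end

section
/- Let λ > 0 and let f : [0, ∞) → ℝ be differentiable with f(t) ≥ 0 for all t ≥ 0 and f′(t) ≤ −2λ (e^{f(t)} − 1) for all t ≥ 0. Then 1 − e^{−f(t)} ≤ e^{−2λt} (1 − e^{−f(0)}) ≤ e^{−2λt} for all t ≥ 0, and f(t) ≤ 2 e^{−2λt} for all t ≥ 1/(2λ). -/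
/-- If `x ≥ 0` and `1 - e⁻ˣ ≤ e⁻¹`, then `x ≤ 2 (1 - e⁻ˣ)`. -/
theorem le_two_mul_one_sub_exp_neg {x : ℝ} (hx : 0 ≤ x)
    (h : 1 - Real.exp (-x) ≤ Real.exp (-1)) : x ≤ 2 * (1 - Real.exp (-x)) := by
  have hinv : Real.exp (-1) ≤ 1 / 2 := by
    rw [Real.exp_neg, ← one_div]
    exact one_div_le_one_div_of_le two_pos (by linarith [Real.add_one_le_exp (1 : ℝ)])
  have hmul : Real.exp x * Real.exp (-x) = 1 := by rw [← Real.exp_add]; simp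
  have hexp : Real.exp x ≤ 2 := by nlinarith [Real.exp_pos x]
  have hnonneg : 0 ≤ 1 - Real.exp (-x) := by simpa using hx
  calc x ≤ Real.exp x - 1 := by linarith [Real.add_one_le_exp x]
    _ = Real.exp x * (1 - Real.exp (-x)) := by rw [mul_sub, hmul, mul_one]
    _ ≤ 2 * (1 - Real.exp (-x)) := by gcongr

/-- If `f' ≤ -c (eᶠ - 1)` on `[0, ∞)` with `c = 2 lam`, then `t ↦ e^{c t} (1 - e^{-f t})` is
antitone there. -/
theorem antitoneOn_exp_mul_one_sub_exp_neg {lam : ℝ} {f f' : ℝ → ℝ}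
    (hderiv : ∀ t, 0 ≤ t → HasDerivAt f (f' t) t)
    (hdiss : ∀ t, 0 ≤ t → f' t ≤ -(2 * lam * (Real.exp (f t) - 1))) :
    AntitoneOn (fun t => Real.exp (2 * lam * t) * (1 - Real.exp (-f t))) (Set.Ici 0) := by
  have hd : ∀ t, 0 ≤ t → HasDerivAt (fun t => Real.exp (2 * lam * t) * (1 - Real.exp (-f t)))
      (Real.exp (2 * lam * t) *
        (2 * lam * (1 - Real.exp (-f t)) + Real.exp (-f t) * f' t)) t := by
    intro t ht
    have h := ((hasDerivAt_id t).const_mul (2 * lam)).exp.mul ((hderiv t ht).neg.exp.const_sub 1)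
    refine h.congr_deriv ?_
    simp only [id, Pi.neg_apply]
    ring
  refine antitoneOn_of_hasDerivWithinAt_nonpos (convex_Ici 0)
    (fun t ht => (hd t ht).continuousAt.continuousWithinAt)
    (fun t ht => (hd t (interior_subset ht)).hasDerivWithinAt) fun t ht => ?_
  refine mul_nonpos_of_nonneg_of_nonpos (Real.exp_pos _).le ?_
  have hmul : Real.exp (-f t) * Real.exp (f t) = 1 := by rw [← Real.exp_add]; simp
  have h := mul_le_mul_of_nonneg_left (hdiss t (interior_subset ht)) (Real.exp_pos (-f t)).le
  linear_combination h - 2 * lam * hmul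


/-- Differential-inequality lemma: if `f : [0,∞) → ℝ` is differentiable
with `f(t) ≥ 0` and `f′(t) ≤ −2λ(e^{f(t)} − 1)` for all `t ≥ 0`, then
`1 − e^{−f(t)} ≤ e^{−2λt}(1 − e^{−f(0)}) ≤ e^{−2λt}` for all `t ≥ 0`, and
`f(t) ≤ 2 e^{−2λt}` for all `t ≥ 1/(2λ)`. -/
theorem differential_inequality_exp_decay
    (lam : ℝ) (hlam : 0 < lam)
    (f f' : ℝ → ℝ)
    (hderiv : ∀ t, 0 ≤ t → HasDerivAt f (f' t) t)
    (hnonneg : ∀ t, 0 ≤ t → 0 ≤ f t)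
    (hdiss : ∀ t, 0 ≤ t → f' t ≤ -(2 * lam * (Real.exp (f t) - 1))) :
    (∀ t, 0 ≤ t →
      1 - Real.exp (-f t) ≤ Real.exp (-(2 * lam * t)) * (1 - Real.exp (-f 0)) ∧
      Real.exp (-(2 * lam * t)) * (1 - Real.exp (-f 0)) ≤ Real.exp (-(2 * lam * t))) ∧
    (∀ t, 1 / (2 * lam) ≤ t → f t ≤ 2 * Real.exp (-(2 * lam * t))) := by
  have hanti := antitoneOn_exp_mul_one_sub_exp_neg hderiv hdiss
  have hdecay : ∀ t, 0 ≤ t →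
      1 - Real.exp (-f t) ≤ Real.exp (-(2 * lam * t)) * (1 - Real.exp (-f 0)) ∧
      Real.exp (-(2 * lam * t)) * (1 - Real.exp (-f 0)) ≤ Real.exp (-(2 * lam * t)) := by
    intro t ht
    constructor
    · have h0 : Real.exp (2 * lam * t) * (1 - Real.exp (-f t)) ≤ 1 - Real.exp (-f 0) := by
        simpa using hanti Set.self_mem_Ici ht ht
      rwa [Real.exp_neg (2 * lam * t), ← div_eq_inv_mul, le_div_iff₀' (Real.exp_pos _)]
    · exact mul_le_of_le_one_right (Real.exp_pos _).le (by linarith [Real.exp_pos (-f 0)])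
  refine ⟨hdecay, fun t ht => ?_⟩
  have ht0 : 0 ≤ t := le_trans (by positivity) ht
  have hlamt : 1 ≤ 2 * lam * t := (div_le_iff₀' (by positivity)).mp ht
  have hbound := (hdecay t ht0).1.trans (hdecay t ht0).2
  have hsmall : Real.exp (-(2 * lam * t)) ≤ Real.exp (-1) := Real.exp_le_exp.mpr (by linarith)
  linarith [le_two_mul_one_sub_exp_neg (hnonneg t ht0) (hbound.trans hsmall)]
end
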